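/- Fix d ≥ 1, reals σ > 0, γ > 0, τ ∈ ℝ, a finite set Z ⊆ ℝ^d consisting of nonzero vectors, vectors θr, θc ∈ ℝ^d, and z* ∈ Z such that ⟨θc, z*⟩ ≤ τ and, for every z ∈ Z with z ≠ z* and ⟨θc, z⟩ ≤ τ, one has ⟨θr, z⟩ < ⟨θr, z*⟩ (z* is the unique best feasible arm). Let V be a symmetric positive definite d×d real matrix, and assume z ≠ z* implies z − z* ≠ 0 for all z ∈ Z. Then the infimum over (θ1, θ2) ∈ Θ̄ of (1/2)·(‖θ1 − θr‖_V²/σ² + ‖θ2 − θc‖_V²/γ²) equals the minimum over z ∈ Z of g(z), where: g(z*) := Δc(z*)²/(2γ²‖z*‖_{V⁻¹}²); for z ≠ z* with ⟨θc, z⟩ > τ and ⟨θr, z⟩ > ⟨θr, z*⟩, g(z) := Δc(z)²/(2γ²‖z‖_{V⁻¹}²); for z ≠ z* with ⟨θc, z⟩ ≤ τ, g(z) := Δr(z)²/(2σ²‖z − z*‖_{V⁻¹}²); and for z ≠ z* with ⟨θc, z⟩ > τ and ⟨θr, z⟩ ≤ ⟨θr, z*⟩, g(z) := Δc(z)²/(2γ²‖z‖_{V⁻¹}²)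 + Δr(z)²/(2σ²‖z − z*‖_{V⁻¹}²). -/

import Mathlib

open Matrix
open scoped Classical

/-- `‖x‖_A := √(xᵀ A x)` for a matrix `A` and vector `x`. -/
noncomputable def qnorm {d : ℕ} (A : Matrix (Fin d) (Fin d) ℝ) (x : Fin d → ℝ) : ℝ :=
  Real.sqrt (x ⬝ᵥ (A *ᵥ x))

lemma qnorm_sq {d : ℕ} {A : Matrix (Fin d) (Fin d) ℝ} (hA : A.PosDef) (x : Fin d → ℝ) :
    qnorm A x ^ 2 = x ⬝ᵥ (A *ᵥ x) := by
  have h := hA.posSemidef.dotProduct_mulVec_nonneg x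
  rw [star_trivial] at h
  exact Real.sq_sqrt h

lemma qnorm_sq_pos {d : ℕ} {A : Matrix (Fin d) (Fin d) ℝ} (hA : A.PosDef) {x : Fin d → ℝ}
    (hx : x ≠ 0) : 0 < qnorm A x ^ 2 := by
  have h := hA.dotProduct_mulVec_pos hx
  rw [star_trivial] at h
  rwa [qnorm_sq hA]

lemma mulVec_inv_mulVec {d : ℕ} {V : Matrix (Fin d) (Fin d) ℝ} (hV : V.PosDef)
    (z : Fin d → ℝ) : V *ᵥ (V⁻¹ *ᵥ z) = z := by
  rw [mulVec_mulVec, mul_nonsing_inv _ ((isUnit_iff_isUnit_det _).1 hV.isUnit), one_mulVec]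

/-- The squared norm of a multiple of the worst-case direction `V⁻¹ z`. -/
lemma qnorm_smul_inv_mulVec_sq {d : ℕ} {V : Matrix (Fin d) (Fin d) ℝ} (hV : V.PosDef)
    (t : ℝ) (z : Fin d → ℝ) : qnorm V (t • (V⁻¹ *ᵥ z)) ^ 2 = t ^ 2 * qnorm V⁻¹ z ^ 2 := by
  rw [qnorm_sq hV, qnorm_sq hV.inv, mulVec_smul, mulVec_inv_mulVec hV, dotProduct_smul,
    smul_dotProduct, dotProduct_comm, smul_eq_mul, smul_eq_mul]
  ring

lemma smul_inv_mulVec_dotProduct {d : ℕ} {V : Matrix (Fin d) (Fin d) ℝ} (hV : V.PosDef)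
    (t : ℝ) (z : Fin d → ℝ) : (t • (V⁻¹ *ᵥ z)) ⬝ᵥ z = t * qnorm V⁻¹ z ^ 2 := by
  rw [qnorm_sq hV.inv, smul_dotProduct, dotProduct_comm, smul_eq_mul]

/-- Cauchy–Schwarz for the dual norms `‖·‖_V` and `‖·‖_{V⁻¹}`. -/
lemma dotProduct_sq_le_qnorm_sq_mul {d : ℕ} {V : Matrix (Fin d) (Fin d) ℝ} (hV : V.PosDef)
    (x z : Fin d → ℝ) : (x ⬝ᵥ z) ^ 2 ≤ qnorm V x ^ 2 * qnorm V⁻¹ z ^ 2 := by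
  rcases eq_or_ne z 0 with rfl | hz
  · rw [dotProduct_zero, zero_pow two_ne_zero]
    positivity
  have hN := qnorm_sq_pos hV.inv hz
  set N := qnorm V⁻¹ z ^ 2 with hNdef
  set w := (x ⬝ᵥ z / N) • (V⁻¹ *ᵥ z) with hw
  have hVw : V *ᵥ w = (x ⬝ᵥ z / N) • z := by
    rw [hw, mulVec_smul, mulVec_inv_mulVec hV]
  have hT : Vᵀ = V := by simpa using hV.isHermitian.eq
  have hwx : w ⬝ᵥ (V *ᵥ x) = (x ⬝ᵥ z / N) * (x ⬝ᵥ z) := by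
    rw [dotProduct_mulVec, ← mulVec_transpose, hT, hVw, smul_dotProduct, smul_eq_mul,
      dotProduct_comm]
  have h0 : 0 ≤ qnorm V (x - w) ^ 2 := sq_nonneg _
  have hww : w ⬝ᵥ z = x ⬝ᵥ z / N * N := smul_inv_mulVec_dotProduct hV _ z
  rw [qnorm_sq hV, mulVec_sub, dotProduct_sub, sub_dotProduct, sub_dotProduct, hwx, hVw,
    dotProduct_smul, dotProduct_smul, hww, smul_eq_mul, smul_eq_mul, ← qnorm_sq hV] at h0
  have h1 : (x ⬝ᵥ z) ^ 2 / N ≤ qnorm V x ^ 2 := by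
    have : x ⬝ᵥ z / N * (x ⬝ᵥ z / N * N) = x ⬝ᵥ z / N * (x ⬝ᵥ z) := by field_simp
    rw [this] at h0
    have h2 : (x ⬝ᵥ z) ^ 2 / N = x ⬝ᵥ z / N * (x ⬝ᵥ z) := by ring
    linarith
  exact (div_le_iff₀ hN).1 h1

lemma sq_div_le_half_qnorm_sq_div {d : ℕ} {V : Matrix (Fin d) (Fin d) ℝ} (hV : V.PosDef)
    {k c : ℝ} (hk : 0 < k) {x z : Fin d → ℝ} (hz : z ≠ 0) (hc : c ^ 2 ≤ (x ⬝ᵥ z) ^ 2) :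
    c ^ 2 / (2 * k ^ 2 * qnorm V⁻¹ z ^ 2) ≤ (1 / 2) * (qnorm V x ^ 2 / k ^ 2) := by
  have hN := qnorm_sq_pos hV.inv hz
  have h := hc.trans (dotProduct_sq_le_qnorm_sq_mul hV x z)
  rw [div_le_iff₀ (by positivity)]
  calc c ^ 2 ≤ _ := h
    _ = _ := by field_simp

/-- A perturbation of prescribed effect on `z` with the smallest possible norm. -/
lemma exists_dotProduct_eq_half_qnorm_sq_div {d : ℕ} {V : Matrix (Fin d) (Fin d) ℝ}
    (hV : V.PosDef) {k : ℝ} (hk : 0 < k) (c : ℝ) (θ : Fin d → ℝ) {z : Fin d → ℝ} (hz : z ≠ 0) :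
    ∃ p : Fin d → ℝ, p ⬝ᵥ z = θ ⬝ᵥ z + c ∧
      (1 / 2) * (qnorm V (p - θ) ^ 2 / k ^ 2) = c ^ 2 / (2 * k ^ 2 * qnorm V⁻¹ z ^ 2) := by
  have hN := qnorm_sq_pos hV.inv hz
  refine ⟨θ + (c / qnorm V⁻¹ z ^ 2) • (V⁻¹ *ᵥ z), ?_, ?_⟩
  · rw [add_dotProduct, smul_inv_mulVec_dotProduct hV, div_mul_cancel₀ _ hN.ne']
  · rw [add_sub_cancel_left, qnorm_smul_inv_mulVec_sq hV]
    field_simp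

lemma qnorm_zero {d : ℕ} (V : Matrix (Fin d) (Fin d) ℝ) : qnorm V 0 = 0 := by
  simp [qnorm]

/-- The infimum over the alternative set `Θ̄` (parameter pairs under which `z*` is not the best
feasible arm) of `(1/2)(‖θ1 − θr‖²_V/σ² + ‖θ2 − θc‖²_V/γ²)` equals the minimum over `z ∈ Z`
of the hardness terms `g(z)` built from the reward gaps `Δr(z) = ⟨θr, z* − z⟩` and cost gaps
`Δc(z) = |τ − ⟨θc, z⟩|`. -/
theorem stmt0 {d : ℕ} (hd : 1 ≤ d) (σ γ τ : ℝ) (hσ : 0 < σ) (hγ : 0 < γ)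
    (Z : Finset (Fin d → ℝ)) (hZ0 : ∀ z ∈ Z, z ≠ 0)
    (θr θc zstar : Fin d → ℝ) (hzstar : zstar ∈ Z)
    (hfeas : θc ⬝ᵥ zstar ≤ τ)
    (hbest : ∀ z ∈ Z, z ≠ zstar → θc ⬝ᵥ z ≤ τ → θr ⬝ᵥ z < θr ⬝ᵥ zstar)
    (V : Matrix (Fin d) (Fin d) ℝ) (hV : V.PosDef)
    (hdiff : ∀ z ∈ Z, z ≠ zstar → z - zstar ≠ 0) :
    IsGLB
      ((fun p : (Fin d → ℝ) × (Fin d → ℝ) =>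
          (1 / 2) * (qnorm V (p.1 - θr) ^ 2 / σ ^ 2 + qnorm V (p.2 - θc) ^ 2 / γ ^ 2)) ''
        {p : (Fin d → ℝ) × (Fin d → ℝ) |
          τ < p.2 ⬝ᵥ zstar ∨
            ∃ z ∈ Z, z ≠ zstar ∧ p.1 ⬝ᵥ zstar ≤ p.1 ⬝ᵥ z ∧ p.2 ⬝ᵥ z ≤ τ})
      (Z.inf' ⟨zstar, hzstar⟩ (fun z =>
        if z = zstar then
          |τ - θc ⬝ᵥ zstar| ^ 2 / (2 * γ ^ 2 * qnorm V⁻¹ zstar ^ 2)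
        else if θc ⬝ᵥ z ≤ τ then
          (θr ⬝ᵥ (zstar - z)) ^ 2 / (2 * σ ^ 2 * qnorm V⁻¹ (z - zstar) ^ 2)
        else if θr ⬝ᵥ zstar < θr ⬝ᵥ z then
          |τ - θc ⬝ᵥ z| ^ 2 / (2 * γ ^ 2 * qnorm V⁻¹ z ^ 2)
        else
          |τ - θc ⬝ᵥ z| ^ 2 / (2 * γ ^ 2 * qnorm V⁻¹ z ^ 2)
            + (θr ⬝ᵥ (zstar - z)) ^ 2 / (2 * σ ^ 2 * qnorm V⁻¹ (z - zstar) ^ 2))) := by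
  constructor
  · rintro _ ⟨⟨p, q⟩, hp, rfl⟩
    have hP : 0 ≤ (1 / 2) * (qnorm V (p - θr) ^ 2 / σ ^ 2) := by positivity
    have hQ : 0 ≤ (1 / 2) * (qnorm V (q - θc) ^ 2 / γ ^ 2) := by positivity
    simp only [mul_add]
    rcases hp with hp | ⟨z, hz, hne, h1, h2⟩
    · refine (Finset.inf'_le _ hzstar).trans ?_
      simp only at hp
      have := sq_div_le_half_qnorm_sq_div hV hγ (c := |τ - θc ⬝ᵥ zstar|) (x := q - θc)
        (hZ0 _ hzstar) (by
          rw [sq_abs, sub_dotProduct]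
          exact pow_le_pow_left₀ (by linarith) (by linarith) 2)
      rw [if_pos rfl]
      linarith
    · refine (Finset.inf'_le _ hz).trans ?_
      simp only at h1 h2
      have hr : θr ⬝ᵥ z ≤ θr ⬝ᵥ zstar →
          (θr ⬝ᵥ (zstar - z)) ^ 2 / (2 * σ ^ 2 * qnorm V⁻¹ (z - zstar) ^ 2) ≤
            (1 / 2) * (qnorm V (p - θr) ^ 2 / σ ^ 2) := fun h =>
        sq_div_le_half_qnorm_sq_div hV hσ (hdiff z hz hne) (by
          rw [dotProduct_sub, dotProduct_sub, sub_dotProduct, sub_dotProduct]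
          exact pow_le_pow_left₀ (by linarith) (by linarith) 2)
      have hc : τ < θc ⬝ᵥ z →
          |τ - θc ⬝ᵥ z| ^ 2 / (2 * γ ^ 2 * qnorm V⁻¹ z ^ 2) ≤
            (1 / 2) * (qnorm V (q - θc) ^ 2 / γ ^ 2) := fun h =>
        sq_div_le_half_qnorm_sq_div hV hγ (hZ0 z hz) (by
          rw [sq_abs, sub_dotProduct, ← neg_sq, ← neg_sq (q ⬝ᵥ z - θc ⬝ᵥ z)]
          exact pow_le_pow_left₀ (by linarith) (by linarith) 2)
      rw [if_neg hne]
      split_ifs with hf hg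
      · linarith [hr (hbest z hz hne hf).le]
      · linarith [hc (not_le.1 hf)]
      · linarith [hr (not_lt.1 hg), hc (not_le.1 hf)]
  · intro b hb
    have hle : ∀ p q : Fin d → ℝ, (τ < q ⬝ᵥ zstar ∨
        ∃ z ∈ Z, z ≠ zstar ∧ p ⬝ᵥ zstar ≤ p ⬝ᵥ z ∧ q ⬝ᵥ z ≤ τ) →
        b ≤ (1 / 2) * (qnorm V (p - θr) ^ 2 / σ ^ 2) +
          (1 / 2) * (qnorm V (q - θc) ^ 2 / γ ^ 2) := fun p q h => by
      rw [← mul_add]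
      exact hb ⟨(p, q), h, rfl⟩
    refine Finset.le_inf' _ _ fun z hz => ?_
    split_ifs with he hf hg
    · have hcont : Filter.Tendsto
          (fun ε : ℝ => (τ - θc ⬝ᵥ zstar + ε) ^ 2 / (2 * γ ^ 2 * qnorm V⁻¹ zstar ^ 2))
          (nhdsWithin 0 (Set.Ioi 0))
          (nhds ((τ - θc ⬝ᵥ zstar + 0) ^ 2 / (2 * γ ^ 2 * qnorm V⁻¹ zstar ^ 2))) :=
        (Continuous.tendsto (by fun_prop) 0).mono_left nhdsWithin_le_nhds
      rw [sq_abs, ← add_zero (τ - θc ⬝ᵥ zstar)]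
      refine ge_of_tendsto hcont (Filter.eventually_of_mem self_mem_nhdsWithin fun ε hε => ?_)
      obtain ⟨q, hq, hval⟩ := exists_dotProduct_eq_half_qnorm_sq_div hV hγ
        (τ - θc ⬝ᵥ zstar + ε) θc (hZ0 zstar hzstar)
      rw [← hval]
      simpa [qnorm_zero] using hle θr q (Or.inl (by linarith [Set.mem_Ioi.1 hε]))
    · obtain ⟨p, hp, hval⟩ := exists_dotProduct_eq_half_qnorm_sq_div hV hσ
        (θr ⬝ᵥ (zstar - z)) θr (hdiff z hz he)
      rw [← hval]
      simp only [dotProduct_sub] at hp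
      simpa [qnorm_zero] using hle p θc (Or.inr ⟨z, hz, he, by linarith, hf⟩)
    · obtain ⟨q, hq, hval⟩ := exists_dotProduct_eq_half_qnorm_sq_div hV hγ
        (τ - θc ⬝ᵥ z) θc (hZ0 z hz)
      rw [sq_abs, ← hval]
      simpa [qnorm_zero] using hle θr q (Or.inr ⟨z, hz, he, hg.le, by linarith⟩)
    · obtain ⟨p, hp, hpval⟩ := exists_dotProduct_eq_half_qnorm_sq_div hV hσ
        (θr ⬝ᵥ (zstar - z)) θr (hdiff z hz he)
      obtain ⟨q, hq, hqval⟩ := exists_dotProduct_eq_half_qnorm_sq_div hV hγ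
        (τ - θc ⬝ᵥ z) θc (hZ0 z hz)
      rw [sq_abs, ← hpval, ← hqval, add_comm]
      simp only [dotProduct_sub] at hp
      exact hle p q (Or.inr ⟨z, hz, he, by linarith, by linarith⟩)
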